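/- (Hall condition for Algorithm 1.) For every subset C ⊆ Fin n with |C| ≤ k_A, the neighborhood ⋃_{c∈C} T_c has cardinality at least |C|. -/

import Mathlib

/-- The cyclic interval `{a, a+1, …, a+ω−1}` of length `ω` starting at `a` in `ZMod k`. -/
def Icyc (k ω : ℕ) (a : ZMod k) : Finset (ZMod k) :=
  (Finset.range ω).image (fun j : ℕ => a + (j : ZMod k))

/-- The support assignment of Algorithm 1: client `i < k_A` gets the cyclic interval of
length `ω_A = s+1` starting at `i`, and passive client `k_A + j` gets the one starting
at `j`. -/
def Tsup (kA s : ℕ) (c : Fin (kA + s)) : Finset (ZMod kA) :=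
  if (c : ℕ) < kA then Icyc kA (s + 1) ((c : ℕ) : ZMod kA)
  else Icyc kA (s + 1) (((c : ℕ) - kA : ℕ) : ZMod kA)

theorem mem_Icyc {k ω : ℕ} {a x : ZMod k} :
    x ∈ Icyc k ω a ↔ ∃ j < ω, a + (j : ZMod k) = x := by
  simp [Icyc]

/-- A nonempty subset of `ZMod k` that is closed under adding `1` is everything. -/
theorem ZMod.eq_univ_of_add_one_mem {k : ℕ} [NeZero k] {S : Finset (ZMod k)}
    (hne : S.Nonempty) (h : ∀ x ∈ S, x + 1 ∈ S) : S = Finset.univ := by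
  obtain ⟨a, ha⟩ := hne
  have hadd (m : ℕ) : a + (m : ZMod k) ∈ S := by
    induction m with
    | zero => simpa using ha
    | succ m ih => simpa [add_assoc] using h _ ih
  refine Finset.eq_univ_of_forall fun y => ?_
  simpa using hadd (y - a).val

/-- The cyclic intervals of length `t + 1` starting in a nonempty set `A` together cover at
least `min k (|A| + t)` residues. -/
theorem min_le_card_biUnion_Icyc {k : ℕ} [NeZero k] {A : Finset (ZMod k)} (hA : A.Nonempty)
    (t : ℕ) : min k (A.card + t) ≤ (A.biUnion (Icyc k (t + 1))).card := by
  induction t with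
  | zero =>
    refine (min_le_right _ _).trans (Finset.card_le_card fun a ha => ?_)
    exact Finset.mem_biUnion.2 ⟨a, ha, mem_Icyc.2 ⟨0, by simp⟩⟩
  | succ t ih =>
    have hsub : A.biUnion (Icyc k (t + 1)) ⊆ A.biUnion (Icyc k (t + 1 + 1)) := by
      refine Finset.biUnion_mono fun a _ x hx => ?_
      obtain ⟨j, hj, rfl⟩ := mem_Icyc.1 hx
      exact mem_Icyc.2 ⟨j, by omega, rfl⟩
    rcases hsub.eq_or_ssubset with heq | hlt
    · have huniv : A.biUnion (Icyc k (t + 1 + 1)) = Finset.univ := by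
        rw [← heq]
        refine ZMod.eq_univ_of_add_one_mem ?_ fun x hx => ?_
        · obtain ⟨a, ha⟩ := hA
          exact ⟨a, Finset.mem_biUnion.2 ⟨a, ha, mem_Icyc.2 ⟨0, by simp⟩⟩⟩
        · obtain ⟨a, ha, hx⟩ := Finset.mem_biUnion.1 hx
          obtain ⟨j, hj, rfl⟩ := mem_Icyc.1 hx
          rw [heq]
          exact Finset.mem_biUnion.2
            ⟨a, ha, mem_Icyc.2 ⟨j + 1, by omega, by push_cast; ring⟩⟩
      rw [huniv, Finset.card_univ, ZMod.card]
      exact min_le_left _ _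
    · have := Finset.card_lt_card hlt
      omega

/-- The first block of the cyclic interval assigned to client `c`. -/
def supportStart (kA s : ℕ) (c : Fin (kA + s)) : ZMod kA :=
  if (c : ℕ) < kA then ((c : ℕ) : ZMod kA) else (((c : ℕ) - kA : ℕ) : ZMod kA)

theorem Tsup_eq_Icyc (kA s : ℕ) (c : Fin (kA + s)) :
    Tsup kA s c = Icyc kA (s + 1) (supportStart kA s c) := by
  unfold Tsup supportStart
  split_ifs <;> rfl

theorem card_le_card_image_supportStart_add (kA s : ℕ) (C : Finset (Fin (kA + s))) :
    C.card ≤ (C.image (supportStart kA s)).card + s := by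
  rw [← Finset.card_filter_add_card_filter_not (s := C) (fun c => (c : ℕ) < kA)]
  refine add_le_add ?_ ?_
  · refine Finset.card_le_card_of_injOn (supportStart kA s) (fun c hc => ?_) ?_
    · exact Finset.mem_image_of_mem _ (Finset.mem_filter.1 hc).1
    · intro c hc d hd hcd
      have hc' := (Finset.mem_filter.1 hc).2
      have hd' := (Finset.mem_filter.1 hd).2
      simp only [supportStart, if_pos hc', if_pos hd'] at hcd
      have := congrArg ZMod.val hcd
      rw [ZMod.val_cast_of_lt hc', ZMod.val_cast_of_lt hd'] at this
      exact Fin.ext this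
  · refine le_of_le_of_eq ?_ (Finset.card_range s)
    refine Finset.card_le_card_of_injOn (fun c => (c : ℕ) - kA) (fun c hc => ?_) ?_
    · have hc' := (Finset.mem_filter.1 hc).2
      have := c.isLt
      simp only [Finset.coe_range, Set.mem_Iio]
      omega
    · intro c hc d hd hcd
      have hc' := (Finset.mem_filter.1 hc).2
      have hd' := (Finset.mem_filter.1 hd).2
      simp only at hcd
      exact Fin.ext (by omega)

/-- Hall condition for Algorithm 1: for every subset `C ⊆ Fin n` with `|C| ≤ k_A`, the
neighborhood `⋃_{c∈C} T_c` has cardinality at least `|C|`. -/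
theorem hall_condition (kA s : ℕ) (hs : 1 ≤ s) (hsk : s < kA)
    (C : Finset (Fin (kA + s))) (hC : C.card ≤ kA) :
    C.card ≤ (C.biUnion (Tsup kA s)).card := by
  rcases C.eq_empty_or_nonempty with rfl | hne
  · simp
  have : NeZero kA := ⟨by omega⟩
  have hU : C.biUnion (Tsup kA s) =
      (C.image (supportStart kA s)).biUnion (Icyc kA (s + 1)) := by
    rw [Finset.image_biUnion]
    exact Finset.biUnion_congr rfl fun c _ => Tsup_eq_Icyc kA s c
  rw [hU]
  exact (le_min hC (card_le_card_image_supportStart_add kA s C)).trans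
    (min_le_card_biUnion_Icyc (hne.image _) s)
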